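/- Let (Ω, F, μ) be a probability space, f₁, …, f_k ∈ L^∞(μ), γ ∈ (1, ∞), δ̃ ∈ (0, ∞) with γ^{1/2} δ̃ ≤ 1. Then for i.i.d. samples x₁, …, xₙ from μ, with probability at least 1 − k(k+1) exp(−3 n γ δ̃²/2), the bound |(1/n) ∑ᵢ f(xᵢ)² − ∫ f² dμ| ≤ 3(3k − 2) max_s ‖f_s‖²_{L^∞} · γ^{1/2} δ̃ holds simultaneously for every f = ∑_{s=1}^k a_s f_s with real coefficients satisfying ∑ a_s² = 1. -/

import Mathlib

open MeasureTheory

/-- Two-sided Hoeffding inequality for the empirical mean of an essentially bounded function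
under the product measure. -/
theorem measureReal_pi_lt_abs_mean_sub_integral_le {Ω : Type*} [MeasurableSpace Ω]
    (μ : Measure Ω) [IsProbabilityMeasure μ] {h : Ω → ℝ} (hm : Measurable h) {M : ℝ}
    (hM : 0 ≤ M) (hb : ∀ᵐ x ∂μ, |h x| ≤ M) {n : ℕ} (hn : 0 < n) {u : ℝ} (hu : 0 ≤ u) :
    (Measure.pi (fun _ : Fin n => μ)).real
        {x | M * u < |(∑ i, h (x i)) / n - ∫ ω, h ω ∂μ|} ≤
      2 * Real.exp (-(n * u ^ 2) / 2) := by
  set P := Measure.pi (fun _ : Fin n => μ)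
  set m := ∫ ω, h ω ∂μ with hm_def
  have hn' : (0 : ℝ) < n := by exact_mod_cast hn
  rcases hM.eq_or_lt with rfl | hM
  · have hzero : h =ᵐ[μ] 0 := by
      filter_upwards [hb] with x hx using abs_nonpos_iff.1 hx
    have hm0 : m = 0 := by rw [hm_def, integral_congr_ae hzero]; simp
    have hall : ∀ᵐ x ∂P, ∀ i, h (x i) = 0 :=
      ae_all_iff.2 fun i => (measurePreserving_eval (fun _ : Fin n => μ) i).quasiMeasurePreserving.ae
        hzero
    have hnull : P {x | 0 * u < |(∑ i, h (x i)) / n - m|} = 0 := by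
      refine measure_eq_zero_iff_ae_notMem.2 ?_
      filter_upwards [hall] with x hx
      simp [hx, hm0]
    rw [measureReal_def, hnull]
    simpa using (Real.exp_pos _).le
  have hsub : ProbabilityTheory.HasSubgaussianMGF (fun ω => h ω - m)
      ((‖M - -M‖₊ / 2) ^ 2) μ :=
    ProbabilityTheory.hasSubgaussianMGF_of_mem_Icc hm.aemeasurable
      (by filter_upwards [hb] with x hx using abs_le.1 hx)
  have hc : (((‖M - -M‖₊ / 2) ^ 2 : NNReal) : ℝ) = M ^ 2 := by
    push_cast
    rw [Real.norm_eq_abs, div_pow, sq_abs]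
    ring
  have tail : ∀ Y : Ω → ℝ, Measurable Y →
      ProbabilityTheory.HasSubgaussianMGF Y ((‖M - -M‖₊ / 2) ^ 2) μ →
      P.real {x | n * (M * u) ≤ ∑ i, Y (x i)} ≤ Real.exp (-(n * u ^ 2) / 2) := by
    intro Y hY hsubY
    have hind : ProbabilityTheory.iIndepFun (fun (i : Fin n) (x : Fin n → Ω) => Y (x i)) P :=
      ProbabilityTheory.iIndepFun_pi fun _ => hY.aemeasurable
    have hsubi : ∀ i ∈ (Finset.univ : Finset (Fin n)), ProbabilityTheory.HasSubgaussianMGF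
        (fun x : Fin n → Ω => Y (x i)) ((‖M - -M‖₊ / 2) ^ 2) P := fun i _ =>
      ProbabilityTheory.HasSubgaussianMGF.of_map (Y := fun x : Fin n → Ω => x i)
        (measurable_pi_apply i).aemeasurable
        (by rw [(measurePreserving_eval (fun _ : Fin n => μ) i).map_eq]; exact hsubY)
    refine (ProbabilityTheory.HasSubgaussianMGF.measure_sum_ge_le_of_iIndepFun hind hsubi
      (ε := n * (M * u)) (by positivity)).trans_eq ?_
    congr 1
    rw [Finset.sum_const, Finset.card_univ, Fintype.card_fin, nsmul_eq_mul]
    rw [NNReal.coe_mul, hc, NNReal.coe_natCast]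
    field_simp
  refine (measureReal_mono (s₂ := {x | n * (M * u) ≤ ∑ i, (h (x i) - m)} ∪
      {x | n * (M * u) ≤ ∑ i, -(h (x i) - m)}) ?_).trans ((measureReal_union_le _ _).trans ?_)
  · intro x hx
    have hx : M * u < |(∑ i, h (x i)) / n - m| := hx
    have hsum : ∑ i, (h (x i) - m) = n * ((∑ i, h (x i)) / n - m) := by
      rw [Finset.sum_sub_distrib]
      simp
      field_simp
    rcases lt_abs.1 hx with hx | hx
    · left
      rw [Set.mem_ofPred_eq, hsum]
      gcongr
    · right
      rw [Set.mem_ofPred_eq, Finset.sum_neg_distrib, hsum, ← mul_neg]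
      gcongr
  · rw [two_mul]
    exact add_le_add (tail _ (hm.sub_const m) hsub) (tail _ (hm.sub_const m).neg hsub.neg)

/-- A quadratic form whose entries are bounded by `c` is bounded by `card ι * c` on the unit
sphere. -/
theorem abs_sum_sum_mul_le_card_mul {ι : Type*} [Fintype ι] {a : ι → ℝ}
    (ha : ∑ s, a s ^ 2 = 1) {D : ι → ι → ℝ} {c : ℝ} (hc : 0 ≤ c) (hD : ∀ s t, |D s t| ≤ c) :
    |∑ s, ∑ t, a s * a t * D s t| ≤ Fintype.card ι * c := by
  calc |∑ s, ∑ t, a s * a t * D s t|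
      ≤ ∑ s, ∑ t, |a s| * |a t| * c := by
        refine (Finset.abs_sum_le_sum_abs _ _).trans (Finset.sum_le_sum fun s _ => ?_)
        refine (Finset.abs_sum_le_sum_abs _ _).trans (Finset.sum_le_sum fun t _ => ?_)
        rw [abs_mul, abs_mul]
        gcongr
        exact hD s t
    _ = (∑ s, |a s|) ^ 2 * c := by
        rw [sq, Finset.sum_mul_sum, Finset.sum_mul]
        simp_rw [Finset.sum_mul]
    _ ≤ Fintype.card ι * c := by
        have := sq_sum_le_card_mul_sum_sq (s := Finset.univ) (f := fun s => |a s|)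
        simp only [sq_abs, ha, mul_one, Finset.card_univ] at this
        gcongr

theorem sq_sum_mul_eq_sum_sum {ι : Type*} [Fintype ι] (a y : ι → ℝ) :
    (∑ s, a s * y s) ^ 2 = ∑ s, ∑ t, a s * a t * (y s * y t) := by
  rw [sq, Finset.sum_mul_sum]
  exact Finset.sum_congr rfl fun s _ => Finset.sum_congr rfl fun t _ => by ring

/-- The deviation of the empirical second moment of a linear combination is the quadratic form of
the deviations of the pairwise products. -/
theorem mean_sq_sub_integral_sq_eq {Ω ι : Type*} [MeasurableSpace Ω] [Fintype ι] {μ : Measure Ω}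
    {f : ι → Ω → ℝ} (hint : ∀ s t, Integrable (fun ω => f s ω * f t ω) μ) (a : ι → ℝ) {n : ℕ}
    (x : Fin n → Ω) :
    (∑ i, (∑ s, a s * f s (x i)) ^ 2) / n - ∫ ω, (∑ s, a s * f s ω) ^ 2 ∂μ =
      ∑ s, ∑ t, a s * a t *
        ((∑ i, f s (x i) * f t (x i)) / n - ∫ ω, f s ω * f t ω ∂μ) := by
  simp_rw [sq_sum_mul_eq_sum_sum a]
  rw [integral_finsetSum _ fun s _ => integrable_finsetSum _ fun t _ => (hint s t).const_mul _,
    Finset.sum_comm, Finset.sum_div, ← Finset.sum_sub_distrib]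
  refine Finset.sum_congr rfl fun s _ => ?_
  rw [integral_finsetSum _ fun t _ => (hint s t).const_mul _,
    Finset.sum_comm, Finset.sum_div, ← Finset.sum_sub_distrib]
  refine Finset.sum_congr rfl fun t _ => ?_
  rw [integral_const_mul, ← Finset.mul_sum]
  ring

theorem card_sigma_Iic_fin (k : ℕ) :
    (((Finset.univ : Finset (Fin k)).sigma fun s => Finset.Iic s).card : ℝ) * 2 =
      k * (k + 1) := by
  rw [Finset.card_sigma]
  simp_rw [Fin.card_Iic]
  rw [Fin.sum_univ_eq_sum_range fun i => i + 1]
  have := Finset.sum_range_id_mul_two (k + 1)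
  rw [Finset.sum_range_succ'] at this
  simp only [add_zero, Nat.add_sub_cancel] at this
  rw [mul_comm (k : ℝ)]
  exact_mod_cast this

/-- **Uniform Bernstein-type bound over a `k`-dimensional function space.**
For a probability space `(Ω, μ)`, bounded measurable functions `f₁, …, f_k` with
`|f_s| ≤ B` a.e., `γ > 1` and `δ̃ > 0` with `γ^{1/2}δ̃ ≤ 1`: with probability at least
`1 − k(k+1)exp(−3nγδ̃²/2)` over i.i.d. samples `x₁, …, xₙ` (modelled by the product
measure `μ^{⊗n}`), simultaneously for every `f = ∑ₛ aₛ fₛ` with `∑ aₛ² = 1`,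
`|(1/n)∑ᵢ f(xᵢ)² − ∫ f² dμ| ≤ 3(3k−2)·max_s ‖f_s‖²_{L∞}·γ^{1/2}δ̃`. -/
theorem stmt19 {Ω : Type*} [MeasurableSpace Ω] (μ : Measure Ω) [IsProbabilityMeasure μ]
    (k : ℕ) (hk : 1 ≤ k) (f : Fin k → Ω → ℝ) (hmeas : ∀ s, Measurable (f s))
    (B : ℝ) (hB : ∀ s, ∀ᵐ x ∂μ, |f s x| ≤ B)
    (γ δ : ℝ) (hγ : 1 < γ) (hδ : 0 < δ) (hγδ : Real.sqrt γ * δ ≤ 1) (n : ℕ) :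
    ENNReal.ofReal (1 - k * (k + 1) * Real.exp (-(3 * n * γ * δ ^ 2) / 2)) ≤
      Measure.pi (fun _ : Fin n => μ)
        {x | ∀ a : Fin k → ℝ, (∑ s, (a s) ^ 2) = 1 →
          |(∑ i, (∑ s, a s * f s (x i)) ^ 2) / n -
              ∫ ω, (∑ s, a s * f s ω) ^ 2 ∂μ| ≤
            3 * (3 * k - 2) * B ^ 2 * Real.sqrt γ * δ} := by
 
  rcases Nat.eq_zero_or_pos n with rfl | hn
  · have hk' : (1 : ℝ) ≤ k := by exact_mod_cast hk
    rw [ENNReal.ofReal_of_nonpos]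
    · exact zero_le
    · simp
      nlinarith
  set P := Measure.pi (fun _ : Fin n => μ)
  set D : Fin k → Fin k → (Fin n → Ω) → ℝ := fun s t x =>
    (∑ i, f s (x i) * f t (x i)) / n - ∫ ω, f s ω * f t ω ∂μ with hD_def
  set u := 3 * (Real.sqrt γ * δ) with hu_def
  have hu : 0 ≤ u := by positivity
  have hu2 : u ^ 2 = 9 * (γ * δ ^ 2) := by
    rw [hu_def, mul_pow, mul_pow, Real.sq_sqrt (by linarith)]
    norm_num
  have hprod : ∀ s t, ∀ᵐ ω ∂μ, |f s ω * f t ω| ≤ B ^ 2 := fun s t => by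
    filter_upwards [hB s, hB t] with ω hs ht
    rw [abs_mul, sq]
    exact mul_le_mul hs ht (abs_nonneg _) ((abs_nonneg _).trans hs)
  have hint : ∀ s t, Integrable (fun ω => f s ω * f t ω) μ := fun s t =>
    Integrable.of_bound ((hmeas s).mul (hmeas t)).aestronglyMeasurable (B ^ 2) (hprod s t)
  set pairs := (Finset.univ : Finset (Fin k)).sigma fun s => Finset.Iic s with hpairs
  set bad : Set (Fin n → Ω) := ⋃ p ∈ pairs, {x | B ^ 2 * u < |D p.1 p.2 x|} with hbad
  have hDm : ∀ s t, Measurable (D s t) := fun s t => by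
    have := hmeas s
    have := hmeas t
    fun_prop
  have hbadm : MeasurableSet bad := pairs.measurableSet_biUnion fun p _ =>
    measurableSet_lt measurable_const (hDm p.1 p.2).abs
  have hPbad : P.real bad ≤ k * (k + 1) * Real.exp (-(3 * n * γ * δ ^ 2) / 2) :=
    calc P.real bad ≤ ∑ p ∈ pairs, P.real {x | B ^ 2 * u < |D p.1 p.2 x|} :=
          measureReal_biUnion_finset_le _ _
      _ ≤ ∑ _p ∈ pairs, 2 * Real.exp (-(n * u ^ 2) / 2) :=
          Finset.sum_le_sum fun p _ => measureReal_pi_lt_abs_mean_sub_integral_le μ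
            ((hmeas p.1).mul (hmeas p.2)) (sq_nonneg B) (hprod p.1 p.2) hn hu
      _ = k * (k + 1) * Real.exp (-(n * u ^ 2) / 2) := by
          rw [Finset.sum_const, nsmul_eq_mul, ← mul_assoc, hpairs, card_sigma_Iic_fin]
      _ ≤ k * (k + 1) * Real.exp (-(3 * n * γ * δ ^ 2) / 2) := by
          have : 0 ≤ n * (γ * δ ^ 2) := by positivity
          gcongr ?_ * Real.exp ?_
          rw [hu2]
          linarith
  calc ENNReal.ofReal (1 - k * (k + 1) * Real.exp (-(3 * n * γ * δ ^ 2) / 2))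
      ≤ ENNReal.ofReal (P.real badᶜ) := by
        rw [probReal_compl_eq_one_sub hbadm]
        gcongr
    _ = P badᶜ := ofReal_measureReal
    _ ≤ _ := by
        refine measure_mono fun x hx a ha => ?_
        have hle : ∀ s t, t ≤ s → |D s t x| ≤ B ^ 2 * u := fun s t hts => by
          by_contra! hlt
          exact hx (Set.mem_biUnion (x := (⟨s, t⟩ : Σ _ : Fin k, Fin k))
            (by simpa [hpairs] using hts) hlt)
        have hsymm : ∀ s t, D s t x = D t s x := fun s t => by
          simp only [hD_def, mul_comm]
        have hall : ∀ s t, |D s t x| ≤ B ^ 2 * u := fun s t =>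
          (le_total t s).elim (hle s t) fun hst => hsymm s t ▸ hle t s hst
        rw [mean_sq_sub_integral_sq_eq hint]
        refine (abs_sum_sum_mul_le_card_mul ha (by positivity) hall).trans ?_
        rw [Fintype.card_fin]
        have hk' : (1 : ℝ) ≤ k := by exact_mod_cast hk
        have hw : 0 ≤ B ^ 2 * (Real.sqrt γ * δ) := by positivity
        calc (k : ℝ) * (B ^ 2 * u) = 3 * k * (B ^ 2 * (Real.sqrt γ * δ)) := by
              rw [hu_def]; ring
          _ ≤ 3 * (3 * k - 2) * (B ^ 2 * (Real.sqrt γ * δ)) := by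
              gcongr
              linarith
          _ = _ := by ring
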